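/- Along any T²-symmetric Einstein flow, at every time τ one has | e^{−2τ} ∫_{S¹} e^{2(V−τ)} Q_τ (Q − ⟨Q⟩) e^ρ dθ | ≲ e^{−τ} e^{2(ΠE)^{1/2}} Π E. -/

import Mathlib

noncomputable section

open Real MeasureTheory intervalIntegral

/-- The θ-mean of a function on the circle of circumference 1 (total measure 1). -/
def circleMean (f : ℝ → ℝ) : ℝ := ∫ θ in (0:ℝ)..1, f θ

/-- The smooth, θ-periodic fields `V, Q, ρ, l` of a T²-symmetric spacetime in areal
coordinates; first argument is `τ`, second is `θ`. -/
structure T2Flow where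
  V : ℝ → ℝ → ℝ
  Q : ℝ → ℝ → ℝ
  ρ : ℝ → ℝ → ℝ
  l : ℝ → ℝ → ℝ
  smooth_V : ContDiff ℝ (⊤ : ℕ∞) (Function.uncurry V)
  smooth_Q : ContDiff ℝ (⊤ : ℕ∞) (Function.uncurry Q)
  smooth_ρ : ContDiff ℝ (⊤ : ℕ∞) (Function.uncurry ρ)
  smooth_l : ContDiff ℝ (⊤ : ℕ∞) (Function.uncurry l)
  periodic_V : ∀ τ, Function.Periodic (V τ) 1
  periodic_Q : ∀ τ, Function.Periodic (Q τ) 1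
  periodic_ρ : ∀ τ, Function.Periodic (ρ τ) 1
  periodic_l : ∀ τ, Function.Periodic (l τ) 1

namespace T2Flow

/-- `V_τ`. -/
def Vτ (F : T2Flow) (τ θ : ℝ) : ℝ := deriv (fun s => F.V s θ) τ
/-- `V_θ`. -/
def Vθ (F : T2Flow) (τ θ : ℝ) : ℝ := deriv (fun x => F.V τ x) θ
/-- `Q_τ`. -/
def Qτ (F : T2Flow) (τ θ : ℝ) : ℝ := deriv (fun s => F.Q s θ) τ
/-- `Q_θ`. -/
def Qθ (F : T2Flow) (τ θ : ℝ) : ℝ := deriv (fun x => F.Q τ x) θ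
/-- `ρ_τ`. -/
def ρτ (F : T2Flow) (τ θ : ℝ) : ℝ := deriv (fun s => F.ρ s θ) τ
/-- `l_τ`. -/
def lτ (F : T2Flow) (τ θ : ℝ) : ℝ := deriv (fun s => F.l s θ) τ
/-- `l_θ`. -/
def lθ (F : T2Flow) (τ θ : ℝ) : ℝ := deriv (fun x => F.l τ x) θ

/-- The energy density
`J = (1/2)[V_τ² + e^{2(τ−ρ)}V_θ² + e^{2(V−τ)}(Q_τ² + e^{2(τ−ρ)}Q_θ²)]`. -/
def J (F : T2Flow) (τ θ : ℝ) : ℝ :=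
  (1/2) * (F.Vτ τ θ ^ 2 + exp (2*(τ - F.ρ τ θ)) * F.Vθ τ θ ^ 2
    + exp (2*(F.V τ θ - τ)) * (F.Qτ τ θ ^ 2 + exp (2*(τ - F.ρ τ θ)) * F.Qθ τ θ ^ 2))

/-- The T²-symmetric vacuum Einstein evolution equations together with the
momentum constraint. -/
def IsEinsteinFlow (F : T2Flow) : Prop :=
  (∀ τ θ : ℝ, deriv (fun s => exp (F.ρ s θ) * F.Vτ s θ) τ
      = deriv (fun x => exp (2*τ - F.ρ τ x) * F.Vθ τ x) θ
        + exp (2*(F.V τ θ - τ) + F.ρ τ θ)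
          * (F.Qτ τ θ ^ 2 - exp (2*(τ - F.ρ τ θ)) * F.Qθ τ θ ^ 2)) ∧
  (∀ τ θ : ℝ, deriv (fun s => exp (F.ρ s θ + 2*(F.V s θ - s)) * F.Qτ s θ) τ
      = deriv (fun x => exp (-F.ρ τ x + 2*F.V τ x) * F.Qθ τ x) θ) ∧
  (∀ τ θ : ℝ, F.lτ τ θ + F.ρτ τ θ + 2 = F.J τ θ) ∧
  (∀ τ θ : ℝ, F.ρτ τ θ = exp (F.l τ θ)) ∧
  (∀ τ θ : ℝ, F.lθ τ θ = F.Vθ τ θ * F.Vτ τ θ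
      + exp (2*(F.V τ θ - τ)) * F.Qθ τ θ * F.Qτ τ θ)

/-- The conserved quantity `A = ∫ e^ρ (V_τ − e^{2(V−τ)} Q_τ Q) dθ`. -/
def A (F : T2Flow) (τ : ℝ) : ℝ :=
  ∫ θ in (0:ℝ)..1,
    exp (F.ρ τ θ) * (F.Vτ τ θ - exp (2*(F.V τ θ - τ)) * F.Qτ τ θ * F.Q τ θ)

/-- The conserved quantity `B = ∫ e^{ρ+2(V−τ)} Q_τ dθ`. -/
def B (F : T2Flow) (τ : ℝ) : ℝ :=
  ∫ θ in (0:ℝ)..1, exp (F.ρ τ θ + 2*(F.V τ θ - τ)) * F.Qτ τ θ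

/-- The energy `E = ∫ e^{ρ−2τ} J dθ`. -/
def E (F : T2Flow) (τ : ℝ) : ℝ := ∫ θ in (0:ℝ)..1, exp (F.ρ τ θ - 2*τ) * F.J τ θ

/-- The `S¹`-volume `Π = ⟨e^ρ⟩`. -/
def Pi (F : T2Flow) (τ : ℝ) : ℝ := ∫ θ in (0:ℝ)..1, exp (F.ρ τ θ)

/-- The correction `Λ = (1/2) e^{−2τ} ∫ V_τ (V − ⟨V⟩ − 1) e^ρ dθ`. -/
def Λ (F : T2Flow) (τ : ℝ) : ℝ :=
  (1/2) * exp (-2*τ) *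
    ∫ θ in (0:ℝ)..1, F.Vτ τ θ * (F.V τ θ - circleMean (F.V τ) - 1) * exp (F.ρ τ θ)

/-- The corrected, normalized energy `H = Π (E + Λ)`. -/
def H (F : T2Flow) (τ : ℝ) : ℝ := F.Pi τ * (F.E τ + F.Λ τ)

/-- The twist potential `Y = ⟨e^{l+ρ+2τ}⟩`. -/
def Y (F : T2Flow) (τ : ℝ) : ℝ := ∫ θ in (0:ℝ)..1, exp (F.l τ θ + F.ρ τ θ + 2*τ)

/-- The error term `Ω = ⟨e^{l+ρ+2τ} J⟩ − e^{2τ} E Y Π⁻¹`. -/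
def Ω (F : T2Flow) (τ : ℝ) : ℝ :=
  (∫ θ in (0:ℝ)..1, exp (F.l τ θ + F.ρ τ θ + 2*τ) * F.J τ θ)
    - exp (2*τ) * F.E τ * F.Y τ / F.Pi τ

end T2Flow

/-- Weighted Cauchy–Schwarz inequality on the unit interval. -/
theorem sq_integral_abs_le {r f : ℝ → ℝ} (hr : Continuous r) (hf : Continuous f) :
    (∫ x in (0:ℝ)..1, |f x|) ^ 2
      ≤ (∫ x in (0:ℝ)..1, exp (r x)) * ∫ x in (0:ℝ)..1, exp (-r x) * f x ^ 2 := by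
  set a := ∫ x in (0:ℝ)..1, exp (r x) with ha
  set s := ∫ x in (0:ℝ)..1, |f x| with hs
  set b := ∫ x in (0:ℝ)..1, exp (-r x) * f x ^ 2 with hb
  have ha0 : 0 < a :=
    intervalIntegral_pos_of_pos (Continuous.intervalIntegrable (by fun_prop) _ _)
      (fun x => exp_pos _) one_pos
  have key : 0 ≤ ∫ x in (0:ℝ)..1, exp (-r x) * (a * |f x| - s * exp (r x)) ^ 2 :=
    integral_nonneg zero_le_one fun x _ => by positivity
  have expand : ∀ x, exp (-r x) * (a * |f x| - s * exp (r x)) ^ 2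
      = a ^ 2 * (exp (-r x) * f x ^ 2) - 2 * a * s * |f x| + s ^ 2 * exp (r x) := by
    intro x
    have h1 : exp (-r x) * exp (r x) = 1 := by rw [← exp_add]; simp
    rw [← sq_abs (f x)]
    linear_combination (s ^ 2 * exp (r x) - 2 * a * s * |f x|) * h1
  simp_rw [expand] at key
  rw [intervalIntegral.integral_add (Continuous.intervalIntegrable (by fun_prop) _ _)
      (Continuous.intervalIntegrable (by fun_prop) _ _),
    intervalIntegral.integral_sub (Continuous.intervalIntegrable (by fun_prop) _ _)
      (Continuous.intervalIntegrable (by fun_prop) _ _),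
    intervalIntegral.integral_const_mul, intervalIntegral.integral_const_mul,
    intervalIntegral.integral_const_mul, ← ha, ← hs, ← hb] at key
  have : 0 ≤ a * (a * b - s ^ 2) := by linarith
  linarith [nonneg_of_mul_nonneg_right this ha0]

theorem abs_sub_le_integral_abs_deriv {u : ℝ → ℝ} (hu : ContDiff ℝ 1 u) {x y : ℝ}
    (hx : x ∈ Set.Icc (0:ℝ) 1) (hy : y ∈ Set.Icc (0:ℝ) 1) :
    |u x - u y| ≤ ∫ z in (0:ℝ)..1, |deriv u z| := by
  wlog hxy : y ≤ x generalizing x y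
  · rw [abs_sub_comm]
    exact this hy hx (le_of_not_ge hxy)
  have hc : Continuous (deriv u) := hu.continuous_deriv le_rfl
  rw [← integral_deriv_eq_sub (fun z _ => (hu.differentiable one_ne_zero) z)
    (hc.intervalIntegrable _ _)]
  exact (abs_integral_le_integral_abs hxy).trans
    (integral_mono_interval hy.1 hxy hx.2 (ae_of_all _ fun _ => abs_nonneg _)
      (hc.abs.intervalIntegrable _ _))

/-- A weight of bounded logarithmic oscillation can be moved inside the integral of the
derivative. -/
theorem exp_mul_abs_sub_le {v q : ℝ → ℝ} (hv : ContDiff ℝ 1 v) (hq : ContDiff ℝ 1 q) {s m : ℝ}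
    (hs : ∫ z in (0:ℝ)..1, |deriv v z| ≤ s)
    (hm : ∫ z in (0:ℝ)..1, |exp (v z) * deriv q z| ≤ m) {x y : ℝ}
    (hx : x ∈ Set.Icc (0:ℝ) 1) (hy : y ∈ Set.Icc (0:ℝ) 1) :
    exp (v x) * |q x - q y| ≤ exp s * m := by
  have hc : Continuous (deriv q) := hq.continuous_deriv le_rfl
  have hvc : Continuous v := hv.continuous
  calc exp (v x) * |q x - q y|
      ≤ exp (v x) * ∫ z in (0:ℝ)..1, |deriv q z| := by
        gcongr
        exact abs_sub_le_integral_abs_deriv hq hx hy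
    _ = ∫ z in (0:ℝ)..1, exp (v x) * |deriv q z| := (intervalIntegral.integral_const_mul _ _).symm
    _ ≤ ∫ z in (0:ℝ)..1, exp s * |exp (v z) * deriv q z| := by
        refine integral_mono_on zero_le_one (Continuous.intervalIntegrable (by fun_prop) _ _)
          (Continuous.intervalIntegrable (by fun_prop) _ _) fun z hz => ?_
        rw [abs_mul, abs_of_pos (exp_pos _), ← mul_assoc, ← exp_add]
        gcongr
        linarith [le_of_abs_le (abs_sub_le_integral_abs_deriv hv hx hz)]
    _ = exp s * ∫ z in (0:ℝ)..1, |exp (v z) * deriv q z| := intervalIntegral.integral_const_mul _ _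
    _ ≤ exp s * m := by gcongr

theorem mul_abs_sub_circleMean_le {q : ℝ → ℝ} (hq : Continuous q) {w M x : ℝ} (hw : 0 ≤ w)
    (h : ∀ y ∈ Set.Icc (0:ℝ) 1, w * |q x - q y| ≤ M) :
    w * |q x - circleMean q| ≤ M := by
  have hmean : q x - circleMean q = ∫ y in (0:ℝ)..1, (q x - q y) := by
    rw [integral_sub (Continuous.intervalIntegrable (by fun_prop) _ _)
      (hq.intervalIntegrable _ _)]
    simp [circleMean]
  calc w * |q x - circleMean q|
      ≤ w * ∫ y in (0:ℝ)..1, |q x - q y| := by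
        rw [hmean]
        gcongr
        exact abs_integral_le_integral_abs zero_le_one
    _ = ∫ y in (0:ℝ)..1, w * |q x - q y| := (intervalIntegral.integral_const_mul _ _).symm
    _ ≤ ∫ _ in (0:ℝ)..1, M :=
        integral_mono_on zero_le_one (Continuous.intervalIntegrable (by fun_prop) _ _)
          (by simp) h
    _ = M := by simp

theorem continuous_deriv_fst {f : ℝ → ℝ → ℝ} (hf : ContDiff ℝ (⊤ : ℕ∞) (Function.uncurry f))
    (τ : ℝ) : Continuous fun θ => deriv (fun s => f s θ) τ := by
  have h : (fun θ => deriv (fun s => f s θ) τ)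
      = fun θ => fderiv ℝ (Function.uncurry f) (τ, θ) (1, 0) := by
    funext θ
    have h1 : HasFDerivAt (Function.uncurry f) (fderiv ℝ (Function.uncurry f) (τ, θ)) (τ, θ) :=
      (hf.differentiable (by simp) (τ, θ)).hasFDerivAt
    exact (h1.comp_hasDerivAt τ ((hasDerivAt_id τ).prodMk (hasDerivAt_const τ θ))).deriv
  rw [h]
  have hc := hf.continuous_fderiv (by simp)
  fun_prop

theorem contDiff_one_slice {f : ℝ → ℝ → ℝ} (hf : ContDiff ℝ (⊤ : ℕ∞) (Function.uncurry f))
    (τ : ℝ) : ContDiff ℝ 1 (f τ) :=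
  (hf.of_le (by exact_mod_cast le_top)).comp (contDiff_const.prodMk contDiff_id)

namespace T2Flow

variable (F : T2Flow) (τ : ℝ)

theorem continuous_Vτ : Continuous (F.Vτ τ) := continuous_deriv_fst F.smooth_V τ

theorem continuous_Qτ : Continuous (F.Qτ τ) := continuous_deriv_fst F.smooth_Q τ

theorem continuous_Vθ : Continuous (F.Vθ τ) :=
  (contDiff_one_slice F.smooth_V τ).continuous_deriv le_rfl

theorem continuous_Qθ : Continuous (F.Qθ τ) :=
  (contDiff_one_slice F.smooth_Q τ).continuous_deriv le_rfl

theorem continuous_V : Continuous (F.V τ) := (contDiff_one_slice F.smooth_V τ).continuous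

theorem continuous_Q : Continuous (F.Q τ) := (contDiff_one_slice F.smooth_Q τ).continuous

theorem continuous_ρ : Continuous (F.ρ τ) := (contDiff_one_slice F.smooth_ρ τ).continuous

theorem continuous_J : Continuous (F.J τ) := by
  have h1 := F.continuous_Vτ τ
  have h2 := F.continuous_Qτ τ
  have h3 := F.continuous_Vθ τ
  have h4 := F.continuous_Qθ τ
  have h5 := F.continuous_V τ
  have h6 := F.continuous_ρ τ
  unfold J
  fun_prop

theorem exp_mul_J (θ : ℝ) :
    2 * (exp (F.ρ τ θ - 2 * τ) * F.J τ θ)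
      = exp (F.ρ τ θ - 2 * τ) * F.Vτ τ θ ^ 2
        + exp (-F.ρ τ θ) * F.Vθ τ θ ^ 2
        + exp (-F.ρ τ θ) * (exp (F.ρ τ θ - τ) * (exp (F.V τ θ - τ) * F.Qτ τ θ)) ^ 2
        + exp (-F.ρ τ θ) * (exp (F.V τ θ - τ) * F.Qθ τ θ) ^ 2 := by
  have h1 : exp (-F.ρ τ θ) = exp (F.ρ τ θ - 2 * τ) * exp (2 * (τ - F.ρ τ θ)) := by
    rw [← exp_add]; ring_nf
  have h2 : exp (2 * (F.V τ θ - τ)) = exp (F.V τ θ - τ) ^ 2 := by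
    rw [← exp_nat_mul]; norm_num
  have h3 : exp (-F.ρ τ θ) * exp (F.ρ τ θ - τ) ^ 2 = exp (F.ρ τ θ - 2 * τ) := by
    rw [← exp_nat_mul, ← exp_add]; push_cast; ring_nf
  rw [J, h2]
  linear_combination (-F.Vθ τ θ ^ 2 - exp (F.V τ θ - τ) ^ 2 * F.Qθ τ θ ^ 2) * h1
    - (exp (F.V τ θ - τ) * F.Qτ τ θ) ^ 2 * h3

theorem integral_abs_le_sqrt_of_sq_le_J {f : ℝ → ℝ} (hf : Continuous f)
    (h : ∀ θ, exp (-F.ρ τ θ) * f θ ^ 2 ≤ 2 * (exp (F.ρ τ θ - 2 * τ) * F.J τ θ)) :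
    ∫ θ in (0:ℝ)..1, |f θ| ≤ √(2 * (F.Pi τ * F.E τ)) := by
  have hρ := F.continuous_ρ τ
  have hJ := F.continuous_J τ
  have hE : ∫ θ in (0:ℝ)..1, exp (-F.ρ τ θ) * f θ ^ 2 ≤ 2 * F.E τ := by
    rw [E, ← intervalIntegral.integral_const_mul]
    exact integral_mono_on zero_le_one (Continuous.intervalIntegrable (by fun_prop) _ _)
      (Continuous.intervalIntegrable (by fun_prop) _ _) fun θ _ => h θ
  have hPi : 0 ≤ F.Pi τ := integral_nonneg zero_le_one fun _ _ => (exp_pos _).le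
  refine le_sqrt_of_sq_le ((sq_integral_abs_le hρ hf).trans ?_)
  calc _ ≤ F.Pi τ * (2 * F.E τ) := mul_le_mul_of_nonneg_left hE hPi
    _ = _ := by ring

theorem Pi_mul_E_nonneg : 0 ≤ F.Pi τ * F.E τ := by
  refine mul_nonneg (integral_nonneg zero_le_one fun _ _ => (exp_pos _).le)
    (integral_nonneg zero_le_one fun θ _ => ?_)
  rw [J]
  positivity

theorem integral_abs_Vθ_le : ∫ θ in (0:ℝ)..1, |F.Vθ τ θ| ≤ √(2 * (F.Pi τ * F.E τ)) := by
  refine F.integral_abs_le_sqrt_of_sq_le_J τ (F.continuous_Vθ τ) fun θ => ?_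
  rw [exp_mul_J, ← sub_nonneg]
  ring_nf
  positivity

theorem integral_abs_exp_mul_Qθ_le :
    ∫ θ in (0:ℝ)..1, |exp (F.V τ θ - τ) * F.Qθ τ θ| ≤ √(2 * (F.Pi τ * F.E τ)) := by
  have h1 := F.continuous_Qθ τ
  have h2 := F.continuous_V τ
  refine F.integral_abs_le_sqrt_of_sq_le_J τ (by fun_prop) fun θ => ?_
  rw [exp_mul_J]
  exact le_add_of_nonneg_left (by positivity)

theorem integral_abs_exp_mul_Qτ_le :
    ∫ θ in (0:ℝ)..1, |exp (F.ρ τ θ - τ) * (exp (F.V τ θ - τ) * F.Qτ τ θ)|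
      ≤ √(2 * (F.Pi τ * F.E τ)) := by
  have h1 := F.continuous_Qτ τ
  have h2 := F.continuous_V τ
  have h3 := F.continuous_ρ τ
  refine F.integral_abs_le_sqrt_of_sq_le_J τ (by fun_prop) fun θ => ?_
  rw [exp_mul_J, add_right_comm]
  exact le_add_of_nonneg_left (by positivity)

theorem exp_mul_abs_Q_sub_circleMean_le {θ : ℝ} (hθ : θ ∈ Set.Icc (0:ℝ) 1) :
    exp (F.V τ θ - τ) * |F.Q τ θ - circleMean (F.Q τ)|
      ≤ exp (√(2 * (F.Pi τ * F.E τ))) * √(2 * (F.Pi τ * F.E τ)) := by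
  refine mul_abs_sub_circleMean_le (F.continuous_Q τ) (exp_pos _).le fun y hy => ?_
  refine exp_mul_abs_sub_le (v := fun x => F.V τ x - τ)
    ((contDiff_one_slice F.smooth_V τ).sub contDiff_const)
    (contDiff_one_slice F.smooth_Q τ) ?_ (F.integral_abs_exp_mul_Qθ_le τ) hθ hy
  simp only [deriv_sub_const]
  exact F.integral_abs_Vθ_le τ

end T2Flow

/-- The `Q`-correction bound:
`|e^{−2τ} ∫ e^{2(V−τ)} Q_τ (Q − ⟨Q⟩) e^ρ dθ| ≲ e^{−τ} e^{2(ΠE)^{1/2}} Π E`. -/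
theorem q_correction_bound :
    ∃ C : ℝ, 0 < C ∧ ∀ (F : T2Flow), F.IsEinsteinFlow → ∀ τ : ℝ,
      |Real.exp (-2*τ) * ∫ θ in (0:ℝ)..1,
          Real.exp (2*(F.V τ θ - τ)) * F.Qτ τ θ * (F.Q τ θ - circleMean (F.Q τ))
            * Real.exp (F.ρ τ θ)|
        ≤ C * (Real.exp (-τ) * Real.exp (2 * Real.sqrt (F.Pi τ * F.E τ))
            * (F.Pi τ * F.E τ)) := by
  refine ⟨2, two_pos, fun F _ τ => ?_⟩
  have hV := F.continuous_V τ
  have hQ := F.continuous_Q τ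
  have hρ := F.continuous_ρ τ
  have hQτ := F.continuous_Qτ τ
  have hPE := F.Pi_mul_E_nonneg τ
  set s := √(2 * (F.Pi τ * F.E τ))
  have hss : s * s = 2 * (F.Pi τ * F.E τ) := mul_self_sqrt (by positivity)
  have hs2 : s ≤ 2 * √(F.Pi τ * F.E τ) := by
    refine sqrt_le_iff.mpr ⟨by positivity, ?_⟩
    rw [mul_pow, sq_sqrt hPE]
    linarith
  set p : ℝ → ℝ := fun θ => exp (F.ρ τ θ - τ) * (exp (F.V τ θ - τ) * F.Qτ τ θ)
  set g : ℝ → ℝ := fun θ => exp (F.V τ θ - τ) * (F.Q τ θ - circleMean (F.Q τ)) with hg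
  have hpc : Continuous p := by fun_prop
  have hgc : Continuous g := by fun_prop
  have hint : ∀ θ, exp (2*(F.V τ θ - τ)) * F.Qτ τ θ * (F.Q τ θ - circleMean (F.Q τ))
      * exp (F.ρ τ θ) = exp τ * (p θ * g θ) := by
    intro θ
    have h1 : exp (2 * (F.V τ θ - τ)) = exp (F.V τ θ - τ) ^ 2 := by
      rw [← exp_nat_mul]; norm_num
    have h2 : exp (F.ρ τ θ) = exp τ * exp (F.ρ τ θ - τ) := by
      rw [← exp_add]; ring_nf
    rw [h1, h2]
    ring
  have hpg : |∫ θ in (0:ℝ)..1, p θ * g θ| ≤ s * (exp s * s) := by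
    calc |∫ θ in (0:ℝ)..1, p θ * g θ|
        ≤ ∫ θ in (0:ℝ)..1, |p θ * g θ| := abs_integral_le_integral_abs zero_le_one
      _ ≤ ∫ θ in (0:ℝ)..1, |p θ| * (exp s * s) := by
          refine integral_mono_on zero_le_one (Continuous.intervalIntegrable (by fun_prop) _ _)
            (Continuous.intervalIntegrable (by fun_prop) _ _) fun θ hθ => ?_
          rw [abs_mul]
          gcongr
          rw [hg, abs_mul, abs_of_pos (exp_pos _)]
          exact F.exp_mul_abs_Q_sub_circleMean_le τ hθ
      _ = (∫ θ in (0:ℝ)..1, |p θ|) * (exp s * s) := intervalIntegral.integral_mul_const _ _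
      _ ≤ s * (exp s * s) := by
          gcongr
          exact F.integral_abs_exp_mul_Qτ_le τ
  simp_rw [hint]
  rw [intervalIntegral.integral_const_mul, ← mul_assoc, ← exp_add, abs_mul, abs_of_pos (exp_pos _),
    show -2 * τ + τ = -τ by ring]
  calc exp (-τ) * |∫ θ in (0:ℝ)..1, p θ * g θ|
      ≤ exp (-τ) * (s * (exp s * s)) := by gcongr
    _ = exp (-τ) * (exp s * (2 * (F.Pi τ * F.E τ))) := by rw [← hss]; ring
    _ ≤ exp (-τ) * (exp (2 * √(F.Pi τ * F.E τ)) * (2 * (F.Pi τ * F.E τ))) := by gcongr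
    _ = _ := by ring
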